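/- arXiv:2002.01355 — 7 statements merged into one kernel-verified Lean document; each statement's English description precedes it below -/
import Mathlib

section
/- Suppose that a surface Ψ in ℝP⁴ has a parametrization Ψ(u,v) = (X₁(u,v) : X₂(u,v) : X₃(u,v) : X₄(u,v) : X₅(u,v)), where X₁, …, X₅ ∈ ℝ_{2,2} satisfy X₁² + X₂² + X₄² = X₅². Assume that all the curves u = const and v = const on Ψ intersect the line l given by x₁ = x₂ = 0, x₄ = x₅. Then Ψ has (possibly besides a one-dimensional subset) another parametrization Ψ(u,v) = (Y₁(u,v) : … : Y₅(u,v)) for some Y₁, …, Y₅ ∈ ℝ_{2,2} satisfying Y₁² + Y₂² + Y₄² = Y₅² and such that Y₁, Y₂, and Y₅ − Y₄ have a common divisor of degree at least 1 in u and of degree at least 1 in v. -/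
open MvPolynomial Set

noncomputable section

/-- The ring `ℝ[u,v]`, where `u` is the variable `X 0` and `v` is the variable `X 1`. -/
abbrev RP2 : Type := MvPolynomial (Fin 2) ℝ

/-- `F ∈ ℝ_{i,j}`, i.e. `deg_u F ≤ i` and `deg_v F ≤ j`. -/
def MemR (i j : ℕ) (F : RP2) : Prop := F.degreeOf 0 ≤ i ∧ F.degreeOf 1 ≤ j

/-- Evaluation of `F ∈ ℝ[u,v]` at `(u,v)`. -/
def pev (F : RP2) (u v : ℝ) : ℝ := MvPolynomial.eval ![u, v] F

/-- For `F ∈ ℝ_{2,2}`, the evaluation of `F` with the variable `v` homogenized to the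
pair `(v : w)` of projective parameters (of degree 2). -/
def hEvalV (F : RP2) (u v w : ℝ) : ℝ :=
  ∑ m ∈ F.support, F.coeff m * u ^ (m 0) * v ^ (m 1) * w ^ (2 - m 1)

/-- For `F ∈ ℝ_{2,2}`, the evaluation of `F` with the variable `u` homogenized to the
pair `(u : w)` of projective parameters (of degree 2). -/
def hEvalU (F : RP2) (u w v : ℝ) : ℝ :=
  ∑ m ∈ F.support, F.coeff m * u ^ (m 0) * w ^ (2 - m 0) * v ^ (m 1)

/-- The point of `ℝ⁵` with homogeneous coordinates `(X₁(u,v), …, X₅(u,v))`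
(indexed by `Fin 5`). -/
def projPt (X : Fin 5 → RP2) (w : ℝ × ℝ) : Fin 5 → ℝ := fun i => pev (X i) w.1 w.2

/-- The affine cone (in `ℝ⁵ ∖ {0}`) over the surface in `ℝP⁴` parametrized by
`(u,v) ↦ (X₁(u,v) : … : X₅(u,v))`.  A subset of the projective surface is one-dimensional
iff the corresponding subcone is (at most) two-dimensional. -/
def projCone (X : Fin 5 → RP2) : Set (Fin 5 → ℝ) :=
  {x | ∃ (c : ℝ) (w : ℝ × ℝ), c ≠ 0 ∧ projPt X w ≠ 0 ∧ x = c • projPt X w}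


/-- An ideal of `R[X]`, `R` a factorial domain, either has a common divisor of positive degree or
contains a nonzero constant. -/
theorem exists_dvd_of_forall_C_notMem {R : Type*} [CommRing R] [IsDomain R]
    [UniqueFactorizationMonoid R] (I : Ideal (Polynomial R))
    (hI : ∀ d : R, Polynomial.C d ∈ I → d = 0) :
    ∃ D : Polynomial R, 1 ≤ D.natDegree ∧ ∀ f ∈ I, D ∣ f := by
  classical
  let K := FractionRing R
  let : NormalizedGCDMonoid R :=
    let := UniqueFactorizationMonoid.strongNormalizationMonoid (α := R)
    UniqueFactorizationMonoid.toNormalizedGCDMonoid R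
  by_cases h0 : I = ⊥
  · exact ⟨Polynomial.X, by simp, fun f hf => by simp_all⟩
  let φ := Polynomial.mapRingHom (algebraMap R K)
  have hφ : Function.Injective φ := Polynomial.map_injective _ (IsFractionRing.injective R K)
  obtain ⟨g, hg⟩ := (IsPrincipalIdealRing.principal (I.map φ)).principal
  have hg' : I.map φ = Ideal.span {g} := hg
  have hdvd : ∀ f ∈ I, g ∣ φ f := fun f hf =>
    Ideal.mem_span_singleton.1 (hg' ▸ Ideal.mem_map_of_mem φ hf)
  have hg0 : g ≠ 0 := by
    rintro rfl
    refine h0 (le_bot_iff.1 fun f hf => ?_)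
    have := hdvd f hf
    rw [zero_dvd_iff, map_eq_zero_iff φ hφ] at this
    simpa using this
  have hgu : g.natDegree ≠ 0 := by
    intro hdeg
    have hunit : IsUnit g := by
      rw [Polynomial.natDegree_eq_zero] at hdeg
      obtain ⟨c, rfl⟩ := hdeg
      exact Polynomial.isUnit_C.2 (isUnit_iff_ne_zero.2 (by simpa using hg0))
    have h1 : (1 : Polynomial K) ∈ I.map φ := by
      rw [hg', Ideal.span_singleton_eq_top.2 hunit]; trivial
    let := Polynomial.algebra R K
    have := Polynomial.isLocalization (nonZeroDivisors R) K
    obtain ⟨⟨x, m⟩, hx⟩ := (IsLocalization.mem_map_algebraMap_iff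
      ((nonZeroDivisors R).map (Polynomial.C : R →+* Polynomial R)) (Polynomial K)).1 h1
    obtain ⟨d, hd, hdm⟩ := m.2
    rw [one_mul] at hx
    have hx' : (m : Polynomial R) = x := hφ hx
    refine nonZeroDivisors.ne_zero hd (hI d ?_)
    have : Polynomial.C d = (x : Polynomial R) := by rw [← hx']; exact hdm
    rw [this]; exact x.2
  obtain ⟨b, hbR, hb⟩ := IsLocalization.integerNormalization_spec (nonZeroDivisors R) g
  set q := IsLocalization.integerNormalization (nonZeroDivisors R) g
  have hbK : algebraMap R K b ≠ 0 :=
    (map_ne_zero_iff _ (IsFractionRing.injective R K)).2 (nonZeroDivisors.ne_zero hbR)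
  have hq : φ q = Polynomial.C (algebraMap R K b) * g := by
    change Polynomial.map _ _ = _
    rw [hb, Polynomial.C_mul', algebraMap_smul]
  refine ⟨q.primPart, ?_, fun f hf => ?_⟩
  · rw [Polynomial.natDegree_primPart]
    have := congrArg Polynomial.natDegree hq
    rw [Polynomial.natDegree_C_mul hbK] at this
    have h2 : (φ q).natDegree = q.natDegree :=
      Polynomial.natDegree_map_eq_of_injective (IsFractionRing.injective R K) q
    omega
  · refine q.isPrimitive_primPart.dvd_of_fraction_map_dvd_fraction_map (K := K) ?_
    have h1 : φ q.primPart ∣ φ q := map_dvd φ ⟨_, (by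
      rw [mul_comm]; exact q.eq_C_content_mul_primPart)⟩
    rw [hq] at h1
    exact ((Polynomial.isUnit_C.2 (isUnit_iff_ne_zero.2 hbK)).dvd_mul_left.1 h1).trans (hdvd f hf)

/-- Polynomials with common zeros over infinitely many values of `v` have a common divisor
of positive degree in `u`. -/
theorem exists_dvd_degreeOf_zero {ι : Type*} (F : ι → RP2) (S : Set ℝ) (hS : S.Infinite)
    (h : ∀ v ∈ S, ∃ u, ∀ i, pev (F i) u v = 0) :
    ∃ D : RP2, 1 ≤ D.degreeOf 0 ∧ ∀ i, D ∣ F i := by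
  let e := finSuccEquiv ℝ 1
  obtain ⟨D, hD, hdvd⟩ := exists_dvd_of_forall_C_notMem
    (Ideal.span (Set.range fun i => e (F i))) fun d hd => by
      refine funext_set (fun _ => S) (fun _ => hS) fun x hx => ?_
      obtain ⟨u, hu⟩ := h (x 0) (hx 0 trivial)
      have hx1 : (Fin.cons u x : Fin 2 → ℝ) = ![u, x 0] := by
        ext i; fin_cases i <;> rfl
      have hle : Ideal.span (Set.range fun i => e (F i)) ≤
          RingHom.ker ((Polynomial.evalRingHom u).comp (Polynomial.mapRingHom (eval x))) := by
        rw [Ideal.span_le]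
        rintro _ ⟨i, rfl⟩
        have := hu i
        rw [pev, ← hx1, eval_eq_eval_mv_eval'] at this
        simpa [RingHom.mem_ker] using this
      simpa [RingHom.mem_ker] using hle hd
  refine ⟨e.symm D, ?_, fun i => ?_⟩
  · rwa [← natDegree_finSuccEquiv, AlgEquiv.apply_symm_apply]
  · have := map_dvd e.symm (hdvd _ (Ideal.subset_span ⟨i, rfl⟩))
    simpa using this

theorem pev_rename_swap (F : RP2) (u v : ℝ) :
    pev (rename (Equiv.swap 0 1) F) u v = pev F v u := by
  rw [pev, pev, eval_rename]
  congr 2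
  ext i; fin_cases i <;> simp

theorem degreeOf_rename_swap (F : RP2) : (rename (Equiv.swap 0 1) F).degreeOf 0 = F.degreeOf 1 := by
  simpa using degreeOf_rename_of_injective (p := F) (Equiv.swap (0 : Fin 2) 1).injective 1

/-- Polynomials with common zeros over infinitely many values of `u` have a common divisor
of positive degree in `v`. -/
theorem exists_dvd_degreeOf_one {ι : Type*} (F : ι → RP2) (S : Set ℝ) (hS : S.Infinite)
    (h : ∀ u ∈ S, ∃ v, ∀ i, pev (F i) u v = 0) :
    ∃ D : RP2, 1 ≤ D.degreeOf 1 ∧ ∀ i, D ∣ F i := by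
  obtain ⟨D, hD, hdvd⟩ := exists_dvd_degreeOf_zero
    (fun i => rename (Equiv.swap (0 : Fin 2) 1) (F i)) S hS
    (by simpa only [pev_rename_swap] using h)
  have hinv (G : RP2) : rename (Equiv.swap (0 : Fin 2) 1) (rename (Equiv.swap 0 1) G) = G := by
    rw [rename_rename, ← Equiv.coe_trans]; simp
  refine ⟨rename (Equiv.swap 0 1) D, ?_, fun i => ?_⟩
  · rwa [← degreeOf_rename_swap, hinv]
  · have := map_dvd (rename (Equiv.swap (0 : Fin 2) 1)) (hdvd i)
    rwa [hinv] at this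

/-- Common divisors of positive degree in `u` and in `v`, respectively, combine to one of positive
degree in both variables. -/
theorem exists_dvd_degreeOf {ι : Type*} (F : ι → RP2) (S T : Set ℝ) (hS : S.Infinite)
    (hT : T.Infinite) (h : ∀ u ∈ S, ∃ v, ∀ i, pev (F i) u v = 0)
    (h' : ∀ v ∈ T, ∃ u, ∀ i, pev (F i) u v = 0) :
    ∃ D : RP2, 1 ≤ D.degreeOf 0 ∧ 1 ≤ D.degreeOf 1 ∧ ∀ i, D ∣ F i := by
  classical
  obtain ⟨D, hD, hDF⟩ := exists_dvd_degreeOf_zero F T hT h'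
  obtain ⟨D', hD', hDF'⟩ := exists_dvd_degreeOf_one F S hS h
  let : GCDMonoid RP2 := UniqueFactorizationMonoid.toGCDMonoid RP2
  have hD0 : D ≠ 0 := ne_zero_of_degreeOf_ne_zero (Nat.one_le_iff_ne_zero.1 hD)
  have hD0' : D' ≠ 0 := ne_zero_of_degreeOf_ne_zero (Nat.one_le_iff_ne_zero.1 hD')
  have hl : lcm D D' ≠ 0 := lcm_ne_zero_iff.2 ⟨hD0, hD0'⟩
  have hle {P Q : RP2} (i : Fin 2) (hPQ : P ∣ Q) (hQ : Q ≠ 0) : P.degreeOf i ≤ Q.degreeOf i := by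
    obtain ⟨R, rfl⟩ := hPQ
    rw [degreeOf_mul_eq (left_ne_zero_of_mul hQ) (right_ne_zero_of_mul hQ)]
    omega
  exact ⟨lcm D D', hD.trans (hle 0 (dvd_lcm_left ..) hl), hD'.trans (hle 1 (dvd_lcm_right ..) hl),
    fun i => lcm_dvd (hDF i) (hDF' i)⟩

/-- The evaluation of `F ∈ ℝ_{2,2}` with both variables homogenized. -/
def biEval (F : RP2) (u u' v v' : ℝ) : ℝ :=
  ∑ m ∈ F.support, F.coeff m * (u ^ m 0 * u' ^ (2 - m 0)) * (v ^ m 1 * v' ^ (2 - m 1))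

theorem pev_eq_biEval (F : RP2) (u v : ℝ) : pev F u v = biEval F u 1 v 1 := by
  simp [pev, biEval, eval_eq', Fin.prod_univ_two, mul_assoc]

theorem hEvalV_eq_biEval (F : RP2) (u v w : ℝ) : hEvalV F u v w = biEval F u 1 v w := by
  simp [hEvalV, biEval, mul_assoc]

theorem hEvalU_eq_biEval (F : RP2) (u w v : ℝ) : hEvalU F u w v = biEval F u w v 1 := by
  simp [hEvalU, biEval, mul_assoc]

theorem biEval_mul {F : RP2} (hF : MemR 2 2 F) (a b u u' v v' : ℝ) :
    biEval F (a * u) (a * u') (b * v) (b * v') = (a * b) ^ 2 * biEval F u u' v v' := by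
  rw [biEval, biEval, Finset.mul_sum]
  refine Finset.sum_congr rfl fun m hm => ?_
  have h0 := (monomial_le_degreeOf 0 hm).trans hF.1
  have h1 := (monomial_le_degreeOf 1 hm).trans hF.2
  have h (x y z : ℝ) {k : ℕ} (hk : k ≤ 2) :
      (x * y) ^ k * (x * z) ^ (2 - k) = x ^ 2 * (y ^ k * z ^ (2 - k)) := by
    have hx : x ^ 2 = x ^ k * x ^ (2 - k) := by rw [← pow_add, Nat.add_sub_of_le hk]
    rw [mul_pow, mul_pow, hx]; ring
  rw [h _ _ _ h0, h _ _ _ h1]; ring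

/-- The polynomial `u² v² F(s + 1/u, t + 1/v)`, for `F ∈ ℝ_{2,2}`. -/
def invSubst (s t : ℝ) (F : RP2) : RP2 :=
  ∑ m ∈ F.support, C (F.coeff m) * ((C s * X 0 + 1) ^ m 0 * X 0 ^ (2 - m 0)) *
    ((C t * X 1 + 1) ^ m 1 * X 1 ^ (2 - m 1))

theorem pev_invSubst (s t : ℝ) (F : RP2) (u v : ℝ) :
    pev (invSubst s t F) u v = biEval F (s * u + 1) u (t * v + 1) v := by
  simp [pev, invSubst, biEval]

theorem memR_invSubst (s t : ℝ) {F : RP2} (hF : MemR 2 2 F) : MemR 2 2 (invSubst s t F) := by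
  have hlin (r : ℝ) (i j : Fin 2) : (C r * X j + 1 : RP2).degreeOf i ≤ if i = j then 1 else 0 := by
    refine (degreeOf_add_le _ _ _).trans (max_le ((degreeOf_C_mul_le _ _ _).trans ?_) ?_)
    · rw [degreeOf_X]
    · simp
  have hfac (r : ℝ) (i j : Fin 2) {k : ℕ} (hk : k ≤ 2) :
      ((C r * X j + 1) ^ k * X j ^ (2 - k) : RP2).degreeOf i ≤ if i = j then 2 else 0 := by
    refine (degreeOf_mul_le _ _ _).trans ((add_le_add (degreeOf_pow_le _ _ _)
      (degreeOf_pow_le _ _ _)).trans ((add_le_add (Nat.mul_le_mul_left _ (hlin r i j))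
      (Nat.mul_le_mul_left _ (degreeOf_X i j).le)).trans ?_))
    split_ifs <;> omega
  have hdeg (i : Fin 2) : (invSubst s t F).degreeOf i ≤ 2 := by
    refine (degreeOf_sum_le _ _ _).trans (Finset.sup_le fun m hm => ?_)
    have h0 := (monomial_le_degreeOf 0 hm).trans hF.1
    have h1 := (monomial_le_degreeOf 1 hm).trans hF.2
    refine (degreeOf_mul_le _ _ _).trans ((add_le_add ((degreeOf_C_mul_le _ _ _).trans
      (hfac s i 0 h0)) (hfac t i 1 h1)).trans ?_)
    fin_cases i <;> simp
  exact ⟨hdeg 0, hdeg 1⟩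

theorem pev_invSubst_eq_mul {F : RP2} (hF : MemR 2 2 F) (s t : ℝ) {u v : ℝ} (hu : u ≠ 0)
    (hv : v ≠ 0) :
    pev (invSubst s t F) u v = (u * v) ^ 2 * pev F (s + u⁻¹) (t + v⁻¹) := by
  rw [pev_invSubst, pev_eq_biEval, ← biEval_mul hF]
  congr 1 <;> field_simp

theorem finite_setOf_pev_left_eq_zero {F : RP2} {s t : ℝ} (h : pev F s t ≠ 0) :
    {u | pev F u t = 0}.Finite := by
  have key (u : ℝ) :
      (aeval ![Polynomial.X, Polynomial.C t] F : Polynomial ℝ).eval u = pev F u t := by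
    clear h
    induction F using MvPolynomial.induction_on with
    | C a => simp [pev]
    | add p q hp hq => simp_all [pev]
    | mul_X p i hp => fin_cases i <;> simp_all [pev]
  have h0 : (aeval ![Polynomial.X, Polynomial.C t] F : Polynomial ℝ) ≠ 0 := by
    intro h0
    rw [← key, h0] at h
    simp at h
  simpa only [Polynomial.IsRoot, key] using Polynomial.finite_setOfPred_isRoot h0

theorem finite_setOf_pev_right_eq_zero {F : RP2} {s t : ℝ} (h : pev F s t ≠ 0) :
    {v | pev F s v = 0}.Finite := by
  rw [← pev_rename_swap] at h
  simpa only [pev_rename_swap] using finite_setOf_pev_left_eq_zero h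

theorem infinite_setOf_add_inv_notMem {Z : Set ℝ} (hZ : Z.Finite) (s : ℝ) :
    {u : ℝ | u ≠ 0 ∧ s + u⁻¹ ∉ Z}.Infinite := by
  have hinj : Function.Injective fun u : ℝ => s + u⁻¹ :=
    (add_right_injective s).comp inv_injective
  have hfin := (Set.finite_singleton (0 : ℝ)).union (hZ.preimage hinj.injOn)
  convert hfin.infinite_compl using 1
  ext u; simp

theorem exists_pev_invSubst_eq_mul_right (s : ℝ) {t u v w : ℝ} (hu : u ≠ 0) (h : v - t * w ≠ 0) :
    ∃ (v' c : ℝ), ∀ F : RP2, MemR 2 2 F →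
      pev (invSubst s t F) u v' = c * hEvalV F (s + u⁻¹) v w := by
  refine ⟨(v - t * w)⁻¹ * w, (u * (v - t * w)⁻¹) ^ 2, fun F hF => ?_⟩
  rw [pev_invSubst, hEvalV_eq_biEval, ← biEval_mul hF]
  congr 1 <;> field_simp
  ring

theorem exists_pev_invSubst_eq_mul_left {s : ℝ} (t : ℝ) {u v w : ℝ} (hv : v ≠ 0)
    (h : u - s * w ≠ 0) :
    ∃ (u' c : ℝ), ∀ F : RP2, MemR 2 2 F →
      pev (invSubst s t F) u' v = c * hEvalU F u w (t + v⁻¹) := by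
  refine ⟨(u - s * w)⁻¹ * w, ((u - s * w)⁻¹ * v) ^ 2, fun F hF => ?_⟩
  rw [pev_invSubst, hEvalU_eq_biEval, ← biEval_mul hF]
  congr 1 <;> field_simp
  ring

theorem hEvalV_mul {F : RP2} (hF : MemR 2 2 F) (u t w : ℝ) :
    hEvalV F u (t * w) w = w ^ 2 * pev F u t := by
  have := biEval_mul hF 1 w u 1 t 1
  rw [hEvalV_eq_biEval, pev_eq_biEval]
  simpa [mul_comm] using this

theorem hEvalU_mul {F : RP2} (hF : MemR 2 2 F) (s w v : ℝ) :
    hEvalU F (s * w) w v = w ^ 2 * pev F s v := by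
  have := biEval_mul hF w 1 s 1 v 1
  rw [hEvalU_eq_biEval, pev_eq_biEval]
  simpa [mul_comm] using this

theorem dimH_range_smul_projPt_le (X : Fin 5 → RP2) {γ : ℝ → ℝ × ℝ} (hγ : ContDiff ℝ 1 γ) :
    dimH (Set.range fun p : ℝ × ℝ => p.1 • projPt X (γ p.2)) ≤ 2 := by
  have h : ContDiff ℝ 1 fun p : ℝ × ℝ => p.1 • projPt X (γ p.2) := by
    refine contDiff_fst.smul (contDiff_pi.2 fun i => ?_)
    simp only [projPt, pev_eq_biEval, biEval]
    fun_prop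
  simpa using h.dimH_range_le

/-- The substitution `(u, v) ↦ (s + 1/u, t + 1/v)` does not change the parametrized surface,
besides a one-dimensional subset. -/
theorem exists_projCone_diff_eq_invSubst {X : Fin 5 → RP2} (hX : ∀ i, MemR 2 2 (X i)) (s t : ℝ) :
    ∃ E : Set (Fin 5 → ℝ), dimH E ≤ 2 ∧
      projCone X \ E = projCone (fun i => invSubst s t (X i)) \ E := by
  set Y : Fin 5 → RP2 := fun i => invSubst s t (X i)
  have hY {u v : ℝ} (hu : u ≠ 0) (hv : v ≠ 0) :
      projPt Y (u, v) = (u * v) ^ 2 • projPt X (s + u⁻¹, t + v⁻¹) := by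
    ext i; exact pev_invSubst_eq_mul (hX i) s t hu hv
  refine ⟨((Set.range fun p : ℝ × ℝ => p.1 • projPt X (s, p.2)) ∪
    (Set.range fun p : ℝ × ℝ => p.1 • projPt X (p.2, t))) ∪
    ((Set.range fun p : ℝ × ℝ => p.1 • projPt Y (0, p.2)) ∪
    (Set.range fun p : ℝ × ℝ => p.1 • projPt Y (p.2, 0))), ?_, ?_⟩
  · simp only [dimH_union, max_le_iff]
    exact ⟨⟨dimH_range_smul_projPt_le X (γ := fun r => (s, r)) (by fun_prop),
      dimH_range_smul_projPt_le X (γ := fun r => (r, t)) (by fun_prop)⟩,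
      dimH_range_smul_projPt_le Y (γ := fun r => (0, r)) (by fun_prop),
      dimH_range_smul_projPt_le Y (γ := fun r => (r, 0)) (by fun_prop)⟩
  · ext x
    refine and_congr_left fun hx => ?_
    simp only [Set.mem_union, Set.mem_range, not_or, not_exists] at hx
    obtain ⟨⟨hs, ht⟩, h0, h0'⟩ := hx
    constructor
    · rintro ⟨c, ⟨u, v⟩, hc, hne, rfl⟩
      have hu : u - s ≠ 0 := fun h => hs (c, v) (by rw [sub_eq_zero.1 h])
      have hv : v - t ≠ 0 := fun h => ht (c, u) (by rw [sub_eq_zero.1 h])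
      have hYX := hY (inv_ne_zero hu) (inv_ne_zero hv)
      simp only [inv_inv, add_sub_cancel] at hYX
      have hk : ((u - s)⁻¹ * (v - t)⁻¹) ^ 2 ≠ 0 := by positivity
      refine ⟨c * (((u - s)⁻¹ * (v - t)⁻¹) ^ 2)⁻¹, ((u - s)⁻¹, (v - t)⁻¹),
        mul_ne_zero hc (inv_ne_zero hk), ?_, ?_⟩
      · rw [hYX]; exact smul_ne_zero hk hne
      · rw [hYX, smul_smul, inv_mul_cancel_right₀ hk]
    · rintro ⟨c, ⟨u, v⟩, hc, hne, rfl⟩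
      have hu : u ≠ 0 := by rintro rfl; exact h0 (c, v) rfl
      have hv : v ≠ 0 := by rintro rfl; exact h0' (c, u) rfl
      rw [hY hu hv] at hne ⊢
      exact ⟨c * (u * v) ^ 2, (s + u⁻¹, t + v⁻¹), by positivity, right_ne_zero_of_smul hne,
        by rw [smul_smul]⟩

/-- Let `Ψ(u,v) = (X₁ : X₂ : X₃ : X₄ : X₅)(u,v)` be a surface in `ℝP⁴` with
`X₁,…,X₅ ∈ ℝ_{2,2}` and `X₁² + X₂² + X₄² = X₅²`.  If every curve `u = const` and `v = const`
on `Ψ` intersects the line `l = {x₁ = x₂ = 0, x₄ = x₅}`, then, possibly besides a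
one-dimensional subset, `Ψ` has another parametrization `(Y₁ : … : Y₅)` with
`Y₁,…,Y₅ ∈ ℝ_{2,2}`, `Y₁² + Y₂² + Y₄² = Y₅²`, such that `Y₁`, `Y₂`, `Y₅ − Y₄` have a common
divisor of degree at least 1 in `u` and at least 1 in `v`.
(Here `X 0, …, X 4` stand for `X₁, …, X₅`; intersection of a coordinate curve with `l` is
expressed via the homogenized parameter `(v : w)`, resp. `(u : w)`, so that the point of the
curve with parameter `∞` is taken into account.) -/
theorem stmt_3
    (X : Fin 5 → RP2)
    (hX : ∀ i, MemR 2 2 (X i))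
    (hquad : X 0 ^ 2 + X 1 ^ 2 + X 3 ^ 2 = X 4 ^ 2)
    -- every curve u = const intersects the line l :
    (hIu : ∀ u0 : ℝ, ∃ v w : ℝ, (v, w) ≠ (0, 0) ∧
      (fun i => hEvalV (X i) u0 v w) ≠ (0 : Fin 5 → ℝ) ∧
      hEvalV (X 0) u0 v w = 0 ∧ hEvalV (X 1) u0 v w = 0 ∧
      hEvalV (X 3) u0 v w = hEvalV (X 4) u0 v w)
    -- every curve v = const intersects the line l :
    (hIv : ∀ v0 : ℝ, ∃ u w : ℝ, (u, w) ≠ (0, 0) ∧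
      (fun i => hEvalU (X i) u w v0) ≠ (0 : Fin 5 → ℝ) ∧
      hEvalU (X 0) u w v0 = 0 ∧ hEvalU (X 1) u w v0 = 0 ∧
      hEvalU (X 3) u w v0 = hEvalU (X 4) u w v0) :
    ∃ Y : Fin 5 → RP2,
      (∀ i, MemR 2 2 (Y i)) ∧
      Y 0 ^ 2 + Y 1 ^ 2 + Y 3 ^ 2 = Y 4 ^ 2 ∧
      (∃ D : RP2, 1 ≤ D.degreeOf 0 ∧ 1 ≤ D.degreeOf 1 ∧
        D ∣ Y 0 ∧ D ∣ Y 1 ∧ D ∣ (Y 4 - Y 3)) ∧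
      -- the new parametrization parametrizes the same surface,
      -- possibly besides a one-dimensional subset :
      ∃ E : Set (Fin 5 → ℝ), dimH E ≤ 2 ∧ projCone X \ E = projCone Y \ E := by
  by_cases hdeg : ∀ u v, pev (X 0) u v = 0 ∧ pev (X 1) u v = 0 ∧ pev (X 3) u v = pev (X 4) u v
  · have hzero {F G : RP2} (h : ∀ u v, pev F u v = pev G u v) : F = G :=
      MvPolynomial.funext fun x => by
        have hx : x = ![x 0, x 1] := by ext i; fin_cases i <;> rfl
        rw [hx]; exact h _ _
    have h0 : X 0 = 0 := hzero fun u v => by simpa [pev] using (hdeg u v).1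
    have h1 : X 1 = 0 := hzero fun u v => by simpa [pev] using (hdeg u v).2.1
    have h34 : X 3 = X 4 := hzero fun u v => (hdeg u v).2.2
    have hD (i : Fin 2) : 1 ≤ (MvPolynomial.X 0 * MvPolynomial.X 1 : RP2).degreeOf i := by
      rw [degreeOf_mul_eq (X_ne_zero 0) (X_ne_zero 1), degreeOf_X, degreeOf_X]
      fin_cases i <;> simp
    exact ⟨X, hX, hquad, ⟨MvPolynomial.X 0 * MvPolynomial.X 1, hD 0, hD 1,
      by simp [h0], by simp [h1], by simp [h34]⟩, ∅, by simp, rfl⟩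
  obtain ⟨s, t, P, hP, hPX⟩ : ∃ (s t : ℝ) (P : RP2), pev P s t ≠ 0 ∧ ∀ u v, pev (X 0) u v = 0 →
      pev (X 1) u v = 0 → pev (X 3) u v = pev (X 4) u v → pev P u v = 0 := by
    push Not at hdeg
    obtain ⟨s, t, h⟩ := hdeg
    by_cases h0 : pev (X 0) s t = 0
    · by_cases h1 : pev (X 1) s t = 0
      · exact ⟨s, t, X 3 - X 4, by simpa [pev, sub_eq_zero] using h h0 h1,
          fun u v _ _ h => by simpa [pev, sub_eq_zero] using h⟩
      · exact ⟨s, t, X 1, h1, fun u v _ h _ => h⟩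
    · exact ⟨s, t, X 0, h0, fun u v h _ _ => h⟩
  have hquadY : invSubst s t (X 0) ^ 2 + invSubst s t (X 1) ^ 2 + invSubst s t (X 3) ^ 2 =
      invSubst s t (X 4) ^ 2 := by
    refine funext_set (fun _ => {0}ᶜ) (fun _ => (Set.finite_singleton 0).infinite_compl)
      fun x hx => ?_
    have hx' : x = ![x 0, x 1] := by ext i; fin_cases i <;> rfl
    have hY i := pev_invSubst_eq_mul (hX i) s t (hx 0 trivial) (hx 1 trivial)
    have hq := congrArg (eval ![s + (x 0)⁻¹, t + (x 1)⁻¹]) hquad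
    simp only [pev, ← hx'] at hY
    simp only [map_add, map_pow] at hq ⊢
    rw [hY, hY, hY, hY]
    linear_combination (x 0 * x 1) ^ 4 * hq
  have hS := infinite_setOf_add_inv_notMem (finite_setOf_pev_left_eq_zero hP) s
  have hT := infinite_setOf_add_inv_notMem (finite_setOf_pev_right_eq_zero hP) t
  obtain ⟨D, hD0, hD1, hD⟩ := exists_dvd_degreeOf
    ![invSubst s t (X 0), invSubst s t (X 1), invSubst s t (X 4) - invSubst s t (X 3)] _ _ hS hT
    (by
      rintro u ⟨hu, hPu⟩
      obtain ⟨v, w, hvw, -, h0, h1, h34⟩ := hIu (s + u⁻¹)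
      have hne : v - t * w ≠ 0 := by
        intro h
        obtain rfl := sub_eq_zero.1 h
        have hw : w ≠ 0 := by rintro rfl; simp at hvw
        simp only [hEvalV_mul (hX _), mul_eq_zero, mul_right_inj' (pow_ne_zero 2 hw),
          pow_ne_zero 2 hw, false_or] at h0 h1 h34
        exact hPu (hPX _ _ h0 h1 h34)
      obtain ⟨v', c, hv'⟩ := exists_pev_invSubst_eq_mul_right s hu hne
      refine ⟨v', fun i => ?_⟩
      fin_cases i
      · simp [hv' _ (hX 0), h0]
      · simp [hv' _ (hX 1), h1]
      · change eval ![u, v'] (_ - _) = 0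
        rw [map_sub, sub_eq_zero]
        exact (hv' _ (hX 4)).trans (h34 ▸ (hv' _ (hX 3)).symm))
    (by
      rintro v ⟨hv, hPv⟩
      obtain ⟨u, w, huw, -, h0, h1, h34⟩ := hIv (t + v⁻¹)
      have hne : u - s * w ≠ 0 := by
        intro h
        obtain rfl := sub_eq_zero.1 h
        have hw : w ≠ 0 := by rintro rfl; simp at huw
        simp only [hEvalU_mul (hX _), mul_eq_zero, mul_right_inj' (pow_ne_zero 2 hw),
          pow_ne_zero 2 hw, false_or] at h0 h1 h34
        exact hPv (hPX _ _ h0 h1 h34)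
      obtain ⟨u', c, hu'⟩ := exists_pev_invSubst_eq_mul_left t hv hne
      refine ⟨u', fun i => ?_⟩
      fin_cases i
      · simp [hu' _ (hX 0), h0]
      · simp [hu' _ (hX 1), h1]
      · change eval ![u', v] (_ - _) = 0
        rw [map_sub, sub_eq_zero]
        exact (hu' _ (hX 4)).trans (h34 ▸ (hu' _ (hX 3)).symm))
  exact ⟨fun i => invSubst s t (X i), fun i => memR_invSubst s t (hX i), hquadY,
    ⟨D, hD0, hD1, hD 0, hD 1, hD 2⟩, exists_projCone_diff_eq_invSubst hX s t⟩

end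
end

section
/- Let X₁, X₂, X₄, X₅ ∈ ℝ_{2,2} be four polynomials satisfying X₁² + X₂² + X₄² = X₅². Assume that X₁, X₂, and X₅ − X₄ have a common divisor of degree at least 1 in u and of degree at least 1 in v. Then there exist polynomials P, Q, R, T ∈ ℝ_{2,2} such that X₁ = 2PRT, X₂ = 2QRT, X₄ = (P² + Q² − R²)T, and X₅ = (P² + Q² + R²)T. -/
open MvPolynomial

noncomputable section

theorem eq_X_mul_add_of_degreeOf_le_one {σ R : Type*} [CommSemiring R] (i : σ)
    {F : MvPolynomial σ R} (hF : F.degreeOf i ≤ 1) :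
    ∃ A B : MvPolynomial σ R, A.degreeOf i = 0 ∧ B.degreeOf i = 0 ∧ F = X i * A + B := by
  refine ⟨F.divMonomial (Finsupp.single i 1), F.modMonomial (Finsupp.single i 1), ?_, ?_, ?_⟩
  · rw [← Nat.le_zero, degreeOf_le_iff]
    intro m hm
    rw [mem_support_iff, coeff_divMonomial, ← mem_support_iff] at hm
    have h := degreeOf_le_iff.mp hF _ hm
    simp at h
    omega
  · rw [← Nat.le_zero, degreeOf_le_iff]
    intro m hm
    by_contra h
    rw [mem_support_iff] at hm
    refine hm (coeff_modMonomial_of_le _ ?_)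
    rw [Finsupp.single_le_iff]
    omega
  · exact (divMonomial_add_modMonomial_single F i).symm

theorem eq_zero_of_sq_add_sq_eq_zero {σ : Type*} {r s : MvPolynomial σ ℝ}
    (h : r ^ 2 + s ^ 2 = 0) : r = 0 ∧ s = 0 := by
  have key (x : σ → ℝ) : eval x r = 0 ∧ eval x s = 0 := by
    have hx := congrArg (eval x) h
    simp only [map_add, map_pow, map_zero] at hx
    constructor <;> nlinarith [sq_nonneg (eval x r), sq_nonneg (eval x s)]
  exact ⟨funext fun x => by simpa using (key x).1, funext fun x => by simpa using (key x).2⟩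

theorem degreeOf_le_of_dvd {σ R : Type*} [CommRing R] [IsDomain R] (i : σ)
    {f g : MvPolynomial σ R} (hg : g ≠ 0) (h : f ∣ g) : f.degreeOf i ≤ g.degreeOf i := by
  obtain ⟨k, rfl⟩ := h
  rw [degreeOf_mul_eq (left_ne_zero_of_mul hg) (right_ne_zero_of_mul hg)]
  omega

/-- A real prime polynomial that is linear in some variable has a formally real residue ring:
it divides a sum of two squares only if it divides both terms. -/
theorem dvd_and_dvd_of_prime_of_dvd_sq_add_sq {σ : Type*} (i : σ) {f x y : MvPolynomial σ ℝ}
    (hf : Prime f) (hfi : f.degreeOf i = 1) (hx : x.degreeOf i ≤ 1) (hy : y.degreeOf i ≤ 1)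
    (h : f ∣ x ^ 2 + y ^ 2) : f ∣ x ∧ f ∣ y := by
  obtain ⟨a, b, ha, hb, hab⟩ := eq_X_mul_add_of_degreeOf_le_one i hfi.le
  obtain ⟨c, d, hc, hd, hcd⟩ := eq_X_mul_add_of_degreeOf_le_one i hx
  obtain ⟨c', d', hc', hd', hcd'⟩ := eq_X_mul_add_of_degreeOf_le_one i hy
  have ha0 : a ≠ 0 := by
    rintro rfl
    rw [hab, mul_zero, zero_add] at hfi
    omega
  have hdeg {p q r s : MvPolynomial σ ℝ} (hp : p.degreeOf i = 0) (hq : q.degreeOf i = 0)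
      (hr : r.degreeOf i = 0) (hs : s.degreeOf i = 0) : (p * q - r * s).degreeOf i = 0 := by
    have h1 := degreeOf_sub_le i (p * q) (r * s)
    have h2 := degreeOf_mul_le i p q
    have h3 := degreeOf_mul_le i r s
    omega
  have hr := hdeg ha hd hc hb
  have hs := hdeg ha hd' hc' hb
  have hdvd : f ∣ (a * d - c * b) ^ 2 + (a * d' - c' * b) ^ 2 := by
    have e : (a * d - c * b) ^ 2 + (a * d' - c' * b) ^ 2 =
        a ^ 2 * (x ^ 2 + y ^ 2) -
          f * (2 * a * x * c - c ^ 2 * f + 2 * a * y * c' - c' ^ 2 * f) := by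
      rw [hab, hcd, hcd']; ring
    rw [e]
    exact dvd_sub (h.mul_left _) (dvd_mul_right _ _)
  have hzero : (a * d - c * b) ^ 2 + (a * d' - c' * b) ^ 2 = 0 := by
    by_contra hne
    have h1 := degreeOf_le_of_dvd i hne hdvd
    have h2 := degreeOf_add_le i ((a * d - c * b) ^ 2) ((a * d' - c' * b) ^ 2)
    have h3 := degreeOf_pow_le i (a * d - c * b) 2
    have h4 := degreeOf_pow_le i (a * d' - c' * b) 2
    rw [hr] at h3
    rw [hs] at h4
    omega
  obtain ⟨hr0, hs0⟩ := eq_zero_of_sq_add_sq_eq_zero hzero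
  have hfa : ¬ f ∣ a := fun hd => by
    have := degreeOf_le_of_dvd i ha0 hd
    omega
  have ex : a * x = f * c := by rw [hab, hcd]; linear_combination hr0
  have ey : a * y = f * c' := by rw [hab, hcd']; linear_combination hs0
  exact ⟨(hf.dvd_or_dvd (ex ▸ dvd_mul_right f c)).resolve_left hfa,
    (hf.dvd_or_dvd (ey ▸ dvd_mul_right f c')).resolve_left hfa⟩

theorem isUnit_of_degreeOf_eq_zero {σ K : Type*} [Field K] {f : MvPolynomial σ K} (hf : f ≠ 0)
    (h : ∀ i, f.degreeOf i = 0) : IsUnit f := by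
  have hC : f = C (coeff 0 f) := by
    rw [← totalDegree_eq_zero_iff_eq_C, totalDegree_eq_zero_iff]
    intro m hm i
    exact Nat.le_zero.mp (degreeOf_le_iff.mp (h i).le m hm)
  rw [hC] at hf ⊢
  exact (isUnit_iff_ne_zero.mpr fun h0 => hf (by rw [h0, map_zero])).map C

theorem exists_primitive_triple {R : Type*} [CommRing R] [IsDomain R]
    [UniqueFactorizationMonoid R] {a b c d : R} (hc : c ≠ 0)
    (ha' : d ∣ a) (hb' : d ∣ b) (hc' : d ∣ c) :
    ∃ g x y z : R, d ∣ g ∧ a = g * x ∧ b = g * y ∧ c = g * z ∧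
      ∀ p, Prime p → p ∣ x → p ∣ y → ¬ p ∣ z := by
  classical
  let := UniqueFactorizationMonoid.toGCDMonoid R
  obtain ⟨x, hx⟩ := (gcd_dvd_left a (gcd b c))
  obtain ⟨y, hy⟩ := (gcd_dvd_right a (gcd b c)).trans (gcd_dvd_left b c)
  obtain ⟨z, hz⟩ := (gcd_dvd_right a (gcd b c)).trans (gcd_dvd_right b c)
  refine ⟨gcd a (gcd b c), x, y, z, dvd_gcd ha' (dvd_gcd hb' hc'), hx, hy, hz, ?_⟩
  intro p hp hpx hpy hpz
  set g := gcd a (gcd b c) with hg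
  have hg0 : g ≠ 0 := fun h => hc (by rw [hz, h, zero_mul])
  have hgp : g * p ∣ g := by
    conv_rhs => rw [hg]
    refine dvd_gcd ?_ (dvd_gcd ?_ ?_)
    · rw [hx]; exact mul_dvd_mul_left g hpx
    · rw [hy]; exact mul_dvd_mul_left g hpy
    · rw [hz]; exact mul_dvd_mul_left g hpz
  exact hp.not_isUnit (isUnit_of_dvd_one ((mul_dvd_mul_iff_left hg0).mp (by rwa [mul_one])))

/-- Let `X₁, X₂, X₄, X₅ ∈ ℝ_{2,2}` satisfy `X₁² + X₂² + X₄² = X₅²`.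
If `X₁`, `X₂`, `X₅ − X₄` have a common divisor of degree at least 1 in `u` and at least 1
in `v`, then there are `P, Q, R, T ∈ ℝ_{2,2}` with `X₁ = 2PRT`, `X₂ = 2QRT`,
`X₄ = (P² + Q² − R²)T`, `X₅ = (P² + Q² + R²)T`. -/
theorem stmt_4
    (X1 X2 X4 X5 : RP2)
    (hX1 : MemR 2 2 X1) (hX2 : MemR 2 2 X2) (hX4 : MemR 2 2 X4) (hX5 : MemR 2 2 X5)
    (hquad : X1 ^ 2 + X2 ^ 2 + X4 ^ 2 = X5 ^ 2)
    (hdiv : ∃ D : RP2, 1 ≤ D.degreeOf 0 ∧ 1 ≤ D.degreeOf 1 ∧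
      D ∣ X1 ∧ D ∣ X2 ∧ D ∣ (X5 - X4)) :
    ∃ P Q R T : RP2, MemR 2 2 P ∧ MemR 2 2 Q ∧ MemR 2 2 R ∧ MemR 2 2 T ∧
      X1 = 2 * P * R * T ∧
      X2 = 2 * Q * R * T ∧
      X4 = (P ^ 2 + Q ^ 2 - R ^ 2) * T ∧
      X5 = (P ^ 2 + Q ^ 2 + R ^ 2) * T := by
  obtain ⟨D, hD0, hD1, hDX1, hDX2, hDZ⟩ := hdiv
  by_cases hZ : X5 - X4 = 0
  · have h5 : X5 = X4 := sub_eq_zero.mp hZ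
    obtain ⟨h1, h2⟩ := eq_zero_of_sq_add_sq_eq_zero (r := X1) (s := X2)
      (by rw [h5] at hquad; linear_combination hquad)
    refine ⟨1, 0, 0, X4, ?_, ?_, ?_, hX4, ?_, ?_, ?_, ?_⟩ <;> simp [MemR, h1, h2, h5]
  obtain ⟨G, x, y, z, hDG, hx, hy, hz, hprim⟩ := exists_primitive_triple hZ hDX1 hDX2 hDZ
  have hG : G ≠ 0 := fun h => hZ (by rw [hz, h, zero_mul])
  have hz0 : z ≠ 0 := fun h => hZ (by rw [hz, h, mul_zero])
  have hZdeg (i : Fin 2) (h4 : X4.degreeOf i ≤ 2) (h5 : X5.degreeOf i ≤ 2) :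
      (X5 - X4).degreeOf i ≤ 2 :=
    (degreeOf_sub_le i X5 X4).trans (max_le h5 h4)
  have hquot (i : Fin 2) (hDi : 1 ≤ D.degreeOf i) (F w : RP2) (hF : F.degreeOf i ≤ 2)
      (hw : F = G * w) : w.degreeOf i ≤ 1 := by
    by_cases hw0 : w = 0
    · simp [hw0]
    rw [hw, degreeOf_mul_eq hG hw0] at hF
    have := degreeOf_le_of_dvd i hG hDG
    omega
  have hx0 := hquot 0 hD0 _ _ hX1.1 hx
  have hx1 := hquot 1 hD1 _ _ hX1.2 hx
  have hy0 := hquot 0 hD0 _ _ hX2.1 hy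
  have hy1 := hquot 1 hD1 _ _ hX2.2 hy
  have hzd0 := hquot 0 hD0 _ _ (hZdeg 0 hX4.1 hX5.1) hz
  have hzd1 := hquot 1 hD1 _ _ (hZdeg 1 hX4.2 hX5.2) hz
  have hmain : G * (x ^ 2 + y ^ 2) = z * (X5 + X4) := by
    refine mul_left_cancel₀ hG ?_
    rw [hx, hy] at hquad
    linear_combination hquad + (X5 + X4) * hz
  have hzG : z ∣ G := by
    refine UniqueFactorizationMonoid.dvd_of_dvd_mul_left_of_no_prime_factors hz0 ?_
      (⟨_, hmain⟩ : z ∣ G * (x ^ 2 + y ^ 2))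
    intro f hfz hfs hf
    have hf0 := (degreeOf_le_of_dvd 0 hz0 hfz).trans hzd0
    have hf1 := (degreeOf_le_of_dvd 1 hz0 hfz).trans hzd1
    have hor : f.degreeOf 0 = 1 ∨ f.degreeOf 1 = 1 := by
      by_contra hcon
      refine hf.not_isUnit (isUnit_of_degreeOf_eq_zero hf.ne_zero ?_)
      rw [Fin.forall_fin_two]
      omega
    obtain ⟨hfx, hfy⟩ : f ∣ x ∧ f ∣ y := hor.elim
      (fun h => dvd_and_dvd_of_prime_of_dvd_sq_add_sq 0 hf h hx0 hy0 hfs)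
      (fun h => dvd_and_dvd_of_prime_of_dvd_sq_add_sq 1 hf h hx1 hy1 hfs)
    exact hprim f hf hfx hfy hfz
  obtain ⟨S, hS⟩ := hzG
  have hhalf : (2 : RP2) * C (1 / 2) = 1 := by
    rw [← map_ofNat C 2, ← C_mul]
    norm_num
  have hT : G = 2 * z * (C (1 / 2) * S) := by
    linear_combination hS - z * S * hhalf
  generalize C (1 / 2) * S = T at hT
  have hTZ : T ∣ X5 - X4 := by
    rw [hz, hT]
    exact (dvd_mul_left T _).mul_right z
  have hsum : X5 + X4 = 2 * (x ^ 2 + y ^ 2) * T := by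
    refine mul_left_cancel₀ hz0 ?_
    rw [← hmain, hT]
    ring
  have hdiff : X5 - X4 = 2 * z ^ 2 * T := by rw [hz, hT]; ring
  have h2 : (2 : RP2) ≠ 0 := two_ne_zero
  refine ⟨x, y, z, T, ⟨by omega, by omega⟩, ⟨by omega, by omega⟩, ⟨by omega, by omega⟩,
    ⟨(degreeOf_le_of_dvd 0 hZ hTZ).trans (hZdeg 0 hX4.1 hX5.1),
      (degreeOf_le_of_dvd 1 hZ hTZ).trans (hZdeg 1 hX4.2 hX5.2)⟩, ?_, ?_, ?_, ?_⟩
  · rw [hx, hT]; ring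
  · rw [hy, hT]; ring
  · exact mul_left_cancel₀ h2 (by linear_combination hsum - hdiff)
  · exact mul_left_cancel₀ h2 (by linear_combination hsum + hdiff)

end
end

section
/- Let F₁, F₂, and F₃ be three polynomials in ℝ[u,v]. Suppose that for infinitely many u₀ ∈ ℝ the univariate polynomials F₁(u₀,v), F₂(u₀,v), and F₃(u₀,v) ∈ ℝ[v] have a common real root. Then F₁, F₂, and F₃ have a common divisor in ℝ[u,v] of degree at least one in v. -/
open MvPolynomial

noncomputable section

open scoped nonZeroDivisors in
/-- An ideal of `R[X]` that contains no nonzero constant has a common divisor of positive degree,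
for `R` a unique factorization domain. -/
theorem Polynomial.exists_common_dvd_or_exists_C_mem {R : Type*} [CommRing R] [IsDomain R]
    [UniqueFactorizationMonoid R] (I : Ideal (Polynomial R)) :
    (∃ D : Polynomial R, 1 ≤ D.natDegree ∧ ∀ f ∈ I, D ∣ f) ∨
      ∃ r : R, r ≠ 0 ∧ Polynomial.C r ∈ I := by
  let : NormalizedGCDMonoid R := Nonempty.some inferInstance
  let K := FractionRing R
  let : Algebra (Polynomial R) (Polynomial K) := Polynomial.algebra R K
  have : IsLocalization (R⁰.map Polynomial.C) (Polynomial K) := Polynomial.isLocalization R⁰ K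
  obtain ⟨G, hG⟩ := IsPrincipalIdealRing.principal (I.map (algebraMap (Polynomial R) (Polynomial K)))
  have hdvd : ∀ f ∈ I, G ∣ f.map (algebraMap R K) := fun f hf =>
    Ideal.mem_span_singleton.1 (hG.le (Ideal.mem_map_of_mem _ hf))
  by_cases hG0 : G = 0
  · refine Or.inl ⟨Polynomial.X, by simp, fun f hf => ?_⟩
    have h0 := hdvd f hf
    rw [hG0, zero_dvd_iff,
      Polynomial.map_eq_zero_iff (IsFractionRing.injective R K)] at h0
    simp [h0]
  by_cases hGu : IsUnit G
  · right
    have h1 : (1 : Polynomial K) ∈ I.map (algebraMap (Polynomial R) (Polynomial K)) := by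
      rw [hG]
      exact Ideal.mem_span_singleton.2 hGu.dvd
    obtain ⟨⟨x, _, r, hr, rfl⟩, hx⟩ :=
      (IsLocalization.mem_map_algebraMap_iff (R⁰.map Polynomial.C) (Polynomial K)).1 h1
    refine ⟨r, nonZeroDivisors.ne_zero hr, ?_⟩
    have hxr : Polynomial.C r = (x : Polynomial R) :=
      Polynomial.map_injective _ (IsFractionRing.injective R K) (by simpa using hx)
    exact hxr ▸ x.2
  · left
    obtain ⟨b, hb, hbG⟩ := IsLocalization.integerNormalization_spec R⁰ G
    set N := IsLocalization.integerNormalization R⁰ G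
    have hbK : algebraMap R K b ≠ 0 := by
      simpa using nonZeroDivisors.ne_zero hb
    have hNG : Associated (N.map (algebraMap R K)) G := by
      rw [hbG, ← algebraMap_smul K b G, Polynomial.smul_eq_C_mul]
      exact associated_unit_mul_left _ _ (Polynomial.isUnit_C.2 hbK.isUnit)
    refine ⟨N.primPart, ?_, fun f hf => ?_⟩
    · rw [N.natDegree_primPart,
        ← Polynomial.natDegree_map_eq_of_injective (IsFractionRing.injective R K),
        Polynomial.natDegree_eq_of_degree_eq (Polynomial.degree_eq_degree_of_associated hNG)]
      exact Polynomial.natDegree_pos_iff_degree_pos.2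
        (Polynomial.degree_pos_of_ne_zero_of_nonunit hG0 hGu)
    · refine N.isPrimitive_primPart.dvd_of_fraction_map_dvd_fraction_map (K := K) ?_
      exact (Polynomial.map_dvd _ N.primPart_dvd).trans (hNG.dvd.trans (hdvd f hf))

/-- The identification of `ℝ[u,v]` with `ℝ[u][v]`. -/
def polynomialInV : RP2 ≃ₐ[ℝ] Polynomial (MvPolynomial (Fin 1) ℝ) :=
  (renameEquiv ℝ (Equiv.swap 0 1)).trans (finSuccEquiv ℝ 1)

theorem natDegree_polynomialInV (F : RP2) : (polynomialInV F).natDegree = F.degreeOf 1 := by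
  have h := degreeOf_rename_of_injective (p := F) (Equiv.swap (0 : Fin 2) 1).injective 1
  rw [Equiv.swap_apply_right] at h
  simpa [polynomialInV, natDegree_finSuccEquiv] using h

theorem pev_eq_eval_polynomialInV (F : RP2) (u v : ℝ) :
    pev F u v = Polynomial.eval v ((polynomialInV F).map (eval ![u])) := by
  have h := eval_eq_eval_mv_eval' ![u] v (rename (Equiv.swap (0 : Fin 2) 1) F)
  rw [eval_rename] at h
  simp only [polynomialInV, AlgEquiv.trans_apply, renameEquiv_apply, ← h, pev]
  congr 2
  ext i
  fin_cases i <;> simp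

/-- Let `F₁, F₂, F₃ ∈ ℝ[u,v]`.  If for infinitely many `u₀ ∈ ℝ` the
univariate polynomials `F₁(u₀,v)`, `F₂(u₀,v)`, `F₃(u₀,v)` have a common real root, then
`F₁`, `F₂`, `F₃` have a common divisor of degree at least one in `v`. -/
theorem stmt_9
    (F1 F2 F3 : RP2)
    (h : {u0 : ℝ | ∃ v0 : ℝ, pev F1 u0 v0 = 0 ∧ pev F2 u0 v0 = 0 ∧ pev F3 u0 v0 = 0}.Infinite) :
    ∃ D : RP2, 1 ≤ D.degreeOf 1 ∧ D ∣ F1 ∧ D ∣ F2 ∧ D ∣ F3 := by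
  let J : Ideal RP2 := Ideal.span {F1, F2, F3}
  have hJ : ∀ F ∈ ({F1, F2, F3} : Set RP2), polynomialInV F ∈ J.comap polynomialInV.symm :=
    fun F hF => by simpa [Ideal.mem_comap] using Ideal.subset_span hF
  rcases Polynomial.exists_common_dvd_or_exists_C_mem (J.comap polynomialInV.symm) with
    ⟨D, hD, hdvd⟩ | ⟨r, hr, hrJ⟩
  · have hsymm : ∀ F ∈ ({F1, F2, F3} : Set RP2), polynomialInV.symm D ∣ F := fun F hF => by
      simpa using map_dvd polynomialInV.symm (hdvd _ (hJ F hF))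
    refine ⟨polynomialInV.symm D, ?_, hsymm F1 (by simp), hsymm F2 (by simp), hsymm F3 (by simp)⟩
    rwa [← natDegree_polynomialInV, AlgEquiv.apply_symm_apply]
  · refine absurd (funext_set (fun _ => _) (fun _ => h) fun x hx => ?_) hr
    obtain ⟨v, h1, h2, h3⟩ := hx 0 trivial
    have hle : J ≤ RingHom.ker (eval ![x 0, v]) := by
      rw [Ideal.span_le]
      rintro F (rfl | rfl | rfl) <;> assumption
    have hr0 : pev (polynomialInV.symm (Polynomial.C r)) (x 0) v = 0 := hle hrJ
    have hx0 : ![x 0] = x := by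
      ext i
      fin_cases i
      rfl
    simpa [pev_eq_eval_polynomialInV, hx0] using hr0

end
end

section
/- Let X₁, X₂, X₄, X₅ ∈ ℝ[u,v] be four polynomials satisfying X₁² + X₂² + X₄² = X₅². Then there exist polynomials P₀, P₁, P₂, P₃, T ∈ ℝ[u,v] such that X₁ = 2(P₀P₁ − P₂P₃)T, X₂ = 2(P₁P₃ + P₀P₂)T, X₄ = (P₁² + P₂² − P₀² − P₃²)T, and X₅ = (P₀² + P₁² + P₂² + P₃²)T. -/
open MvPolynomial

noncomputable section

/-- In a quadratic extension `ι : R → S` of factorial domains with conjugation `σ`, a factorization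
`z * σ z = a * b` over `R` of a norm comes from a factorization of `z`. -/
theorem exists_factorization_of_norm_eq_mul {R S : Type*} [CommRing R] [IsDomain R]
    [UniqueFactorizationMonoid R] [CommRing S] [IsDomain S] [UniqueFactorizationMonoid S]
    (ι : R →+* S) (hι : Function.Injective ι) (σ : S →+* S) (hσι : ∀ r, σ (ι r) = ι r)
    (hσσ : ∀ z, σ (σ z) = z) (hN : ∀ z, ∃ r, ι r = z * σ z) (a b : R) (z : S)
    (h : z * σ z = ι a * ι b) :
    ∃ (t : R) (x y : S), z = ι t * x * y ∧ ι a = ι t * (y * σ y) ∧ ι b = ι t * (x * σ x) := by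
  induction a using (IsWellFounded.wf (r := DvdNotUnit (α := R))).induction generalizing b z with
  | _ a ih =>
  by_cases ha0 : a = 0
  · have hz : z = 0 := by
      have : z * σ z = 0 := by rw [h, ha0, map_zero, zero_mul]
      rcases mul_eq_zero.1 this with h1 | h1
      · exact h1
      · rw [← hσσ z, h1, map_zero]
    exact ⟨b, 1, 0, by simp [hz], by simp [ha0], by simp⟩
  by_cases hau : IsUnit a
  · obtain ⟨c, hc⟩ := hau.exists_right_inv
    have hc' : ι a * ι c = 1 := by rw [← map_mul, hc, map_one]
    refine ⟨a, ι c * z, 1, ?_, by simp, ?_⟩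
    · linear_combination (-z) * hc'
    · rw [map_mul, hσι]
      linear_combination (-(ι a * ι c ^ 2)) * h - (ι a * ι c + 1) * ι b * hc'
  obtain ⟨p, hp, a', rfl⟩ : ∃ p, Prime p ∧ p ∣ a := by
    obtain ⟨p, hp, hpa⟩ := WfDvdMonoid.exists_irreducible_factor hau ha0
    exact ⟨p, hp.prime, hpa⟩
  have ha'0 : a' ≠ 0 := right_ne_zero_of_mul ha0
  have hιp : ι p ≠ 0 := (map_ne_zero_iff ι hι).2 hp.ne_zero
  have inert : Prime (ι p) →
      ∃ (t : R) (x y : S), z = ι t * x * y ∧ ι (p * a') = ι t * (y * σ y) ∧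
        ι b = ι t * (x * σ x) := by
    intro hP
    have hpz : ι p ∣ z := by
      have : ι p ∣ z * σ z := ⟨ι a' * ι b, by rw [h, map_mul, mul_assoc]⟩
      rcases hP.dvd_or_dvd this with h1 | h1
      · exact h1
      · have := map_dvd σ h1
        rwa [hσι, hσσ] at this
    obtain ⟨w, rfl⟩ := hpz
    rw [map_mul, map_mul, hσι] at h
    have h2 : ι p * (w * σ w) = ι a' * ι b := by
      apply mul_left_cancel₀ hιp
      linear_combination h
    obtain ⟨n, hn⟩ := hN w
    have h3 : p * n = a' * b := by
      apply hι
      rw [map_mul, map_mul, hn, h2]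
    rcases hp.dvd_or_dvd (Dvd.intro n h3) with ⟨d, rfl⟩ | ⟨d, rfl⟩
    · obtain ⟨t, x, y, e1, e2, e3⟩ := ih d
        ⟨right_ne_zero_of_mul ha'0, p * p, fun hu => hp.not_isUnit (isUnit_of_mul_isUnit_left hu),
          by ring⟩ b w (by
          apply mul_left_cancel₀ hιp
          rw [h2, map_mul, mul_assoc])
      refine ⟨t, x, ι p * y, ?_, ?_, e3⟩
      · rw [e1]; ring
      · rw [map_mul, map_mul, map_mul, hσι, e2]; ring
    · obtain ⟨t, x, y, e1, e2, e3⟩ := ih a' ⟨ha'0, p, hp.not_isUnit, by ring⟩ d w (by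
          apply mul_left_cancel₀ hιp
          rw [h2, map_mul]; ring)
      refine ⟨p * t, x, y, ?_, ?_, ?_⟩
      · rw [e1, map_mul]; ring
      · rw [map_mul, map_mul, e2]; ring
      · rw [map_mul, map_mul, e3]; ring
  have hpS : ¬ IsUnit (ι p) := by
    intro hu
    obtain ⟨w, hw⟩ := hu.exists_right_inv
    obtain ⟨n, hn⟩ := hN w
    have h1 : ι p * σ w = 1 := by rw [← hσι, ← map_mul, hw, map_one]
    apply hp.not_isUnit
    refine IsUnit.of_mul_eq_one (p * n) (hι ?_)
    rw [map_mul, map_mul, hn, map_one]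
    linear_combination ι p * σ w * hw + h1
  obtain ⟨q, hq, m, hm⟩ : ∃ q, Prime q ∧ q ∣ ι p := by
    obtain ⟨q, hq, hqa⟩ := WfDvdMonoid.exists_irreducible_factor hpS hιp
    exact ⟨q, hq.prime, hqa⟩
  obtain ⟨n, hn⟩ := hN q
  obtain ⟨k, hk⟩ := hN m
  have hpp : n * k = p ^ 2 := by
    apply hι
    have : ι p = σ q * σ m := by rw [← map_mul, ← hm, hσι]
    rw [map_mul, map_pow, hn, hk, sq]
    nth_rewrite 1 [hm]
    rw [this]; ring
  obtain ⟨i, hi, hassoc⟩ := (dvd_prime_pow hp 2).1 (Dvd.intro k hpp)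
  obtain ⟨c, hc⟩ := hassoc
  have hcu : ι ↑c * ι ↑c⁻¹ = 1 := by rw [← map_mul, Units.mul_inv, map_one]
  interval_cases i
  · exfalso
    apply hq.not_isUnit
    refine IsUnit.of_mul_eq_one (σ q * ι c) ?_
    rw [← mul_assoc, ← hn, ← map_mul, hc, pow_zero, map_one]
  · rw [pow_one] at hc
    have hpq : ι p = q * σ q * ι c := by rw [← hn, ← map_mul, hc]
    have split : ∀ r : S, Prime r → ι p = r * σ r * ι c → r ∣ z →
        ∃ (t : R) (x y : S), z = ι t * x * y ∧ ι (p * a') = ι t * (y * σ y) ∧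
          ι b = ι t * (x * σ x) := by
      rintro r hr hpr ⟨w, rfl⟩
      have hσr : σ r ≠ 0 := fun h0 => hr.ne_zero (by rw [← hσσ r, h0, map_zero])
      obtain ⟨t, x, y, e1, e2, e3⟩ := ih (c * a')
        ⟨mul_ne_zero c.ne_zero ha'0, ↑c⁻¹ * p,
          fun hu => hp.not_isUnit (isUnit_of_mul_isUnit_right hu), by
            linear_combination (-(p * a')) * c.mul_inv⟩ b w (by
          apply mul_left_cancel₀ (mul_ne_zero hr.ne_zero hσr)
          rw [map_mul, map_mul, hpr] at h
          rw [map_mul]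
          linear_combination h)
      refine ⟨t, x, r * y, ?_, ?_, e3⟩
      · rw [e1]; ring
      · rw [map_mul] at e2
        rw [map_mul, map_mul, hpr]
        linear_combination r * σ r * e2
    have : q ∣ z * σ z := ⟨m * ι a' * ι b, by rw [h, map_mul, hm]; ring⟩
    rcases hq.dvd_or_dvd this with h1 | h1
    · exact split q hq hpq h1
    · have h2 := map_dvd σ h1
      rw [hσσ] at h2
      let e : S ≃+* S := RingEquiv.ofRingHom σ σ (RingHom.ext hσσ) (RingHom.ext hσσ)
      exact split (σ q) ((MulEquiv.prime_iff e).2 hq) (by rw [hσσ, hpq]; ring) h2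
  · apply inert
    have hku : k * ↑c⁻¹ = 1 := by
      have hn0 : n ≠ 0 := by
        rintro rfl
        exact pow_ne_zero 2 hp.ne_zero (by rw [← hc, zero_mul])
      apply mul_left_cancel₀ hn0
      linear_combination ↑c⁻¹ * hpp - ↑c⁻¹ * hc + n * c.mul_inv
    have hmu : IsUnit m := by
      refine IsUnit.of_mul_eq_one (σ m * ι ↑c⁻¹) ?_
      rw [← mul_assoc, ← hk, ← map_mul, hku, map_one]
    rw [hm]
    exact (associated_mul_unit_right q m hmu).prime hq

/-- Every complex polynomial is the sum of a real polynomial and `i` times a real polynomial. -/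
theorem exists_re_add_I_mul_im {τ : Type*} (z : MvPolynomial τ ℂ) :
    ∃ x y : MvPolynomial τ ℝ,
      z = map Complex.ofRealHom x + C Complex.I * map Complex.ofRealHom y := by
  induction z using MvPolynomial.induction_on with
  | C w =>
    refine ⟨C w.re, C w.im, ?_⟩
    rw [map_C, map_C, ← C_mul, ← C_add]
    congr 1
    rw [mul_comm]
    exact (Complex.re_add_im w).symm
  | add p q hp hq =>
    obtain ⟨x, y, rfl⟩ := hp
    obtain ⟨x', y', rfl⟩ := hq
    exact ⟨x + x', y + y', by simp only [map_add]; ring⟩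
  | mul_X p i hp =>
    obtain ⟨x, y, rfl⟩ := hp
    exact ⟨x * X i, y * X i, by simp only [map_mul, map_X]; ring⟩

/-- **parametrization of Pythagorean 4-tuples.**
If `X₁, X₂, X₄, X₅ ∈ ℝ[u,v]` satisfy `X₁² + X₂² + X₄² = X₅²`, then there are
`P₀, P₁, P₂, P₃, T ∈ ℝ[u,v]` with `X₁ = 2(P₀P₁ − P₂P₃)T`, `X₂ = 2(P₁P₃ + P₀P₂)T`,
`X₄ = (P₁² + P₂² − P₀² − P₃²)T`, `X₅ = (P₀² + P₁² + P₂² + P₃²)T`. -/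
theorem stmt_13
    (X1 X2 X4 X5 : RP2)
    (hquad : X1 ^ 2 + X2 ^ 2 + X4 ^ 2 = X5 ^ 2) :
    ∃ P0 P1 P2 P3 T : RP2,
      X1 = 2 * (P0 * P1 - P2 * P3) * T ∧
      X2 = 2 * (P1 * P3 + P0 * P2) * T ∧
      X4 = (P1 ^ 2 + P2 ^ 2 - P0 ^ 2 - P3 ^ 2) * T ∧
      X5 = (P0 ^ 2 + P1 ^ 2 + P2 ^ 2 + P3 ^ 2) * T := by
  let ι : RP2 →+* MvPolynomial (Fin 2) ℂ := map Complex.ofRealHom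
  let σ : MvPolynomial (Fin 2) ℂ →+* MvPolynomial (Fin 2) ℂ := map (starRingEnd ℂ)
  let J : MvPolynomial (Fin 2) ℂ := C Complex.I
  have hι : Function.Injective ι := map_injective _ Complex.ofRealHom.injective
  have hJ : J * J = -1 := by
    simp only [J, ← C_mul, Complex.I_mul_I, C_neg, C_1]
  have hσJ : σ J = -J := by simp [σ, J]
  have hσι : ∀ r, σ (ι r) = ι r := by
    intro r
    simp only [σ, ι, map_map]
    congr 2
    ext x
    simp
  have hσσ : ∀ z, σ (σ z) = z := by
    intro z
    have hid : (starRingEnd ℂ).comp (starRingEnd ℂ) = RingHom.id ℂ :=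
      RingHom.ext Complex.conj_conj
    simp only [σ, map_map, hid, map_id]
  have hdec : ∀ z, ∃ x y, z = ι x + J * ι y := exists_re_add_I_mul_im
  have hnorm : ∀ x y, (ι x + J * ι y) * σ (ι x + J * ι y) = ι (x ^ 2 + y ^ 2) := by
    intro x y
    simp only [map_add, map_mul, map_pow, hσι, hσJ]
    linear_combination (-(ι y) ^ 2) * hJ
  have hN : ∀ z, ∃ r, ι r = z * σ z := by
    intro z
    obtain ⟨x, y, rfl⟩ := hdec z
    exact ⟨_, (hnorm x y).symm⟩
  have hinj : ∀ x y x' y', ι x + J * ι y = ι x' + J * ι y' → x = x' ∧ y = y' := by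
    intro x y x' y' h
    have hσ := congrArg σ h
    simp only [map_add, map_mul, hσι, hσJ] at hσ
    have h2 : (2 : MvPolynomial (Fin 2) ℂ) ≠ 0 := two_ne_zero
    constructor
    · apply hι
      apply mul_left_cancel₀ h2
      linear_combination h + hσ
    · apply hι
      apply mul_left_cancel₀ h2
      linear_combination (-J) * h + J * hσ + 2 * (ι y - ι y') * hJ
  obtain ⟨t, x, y, e1, e2, e3⟩ := exists_factorization_of_norm_eq_mul ι hι σ hσι hσσ hN
    (X5 + X4) (X5 - X4) (ι X1 + J * ι X2) (by
      rw [hnorm, ← map_mul]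
      congr 1
      linear_combination hquad)
  obtain ⟨P0, P3, rfl⟩ := hdec x
  obtain ⟨P1, P2, rfl⟩ := hdec y
  rw [hnorm, ← map_mul] at e2 e3
  have f2 := hι e2
  have f3 := hι e3
  obtain ⟨g1, g2⟩ := hinj X1 X2 (t * (P0 * P1 - P2 * P3)) (t * (P1 * P3 + P0 * P2)) (by
    rw [e1]
    simp only [map_mul, map_add, map_sub]
    linear_combination ι t * ι P2 * ι P3 * hJ)
  have hhalf : (2 : RP2) * C (1 / 2) = 1 := by
    rw [show (2 : RP2) = C 2 from (map_ofNat C 2).symm, ← C_mul]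
    norm_num
  refine ⟨P0, P1, P2, P3, C (1 / 2) * t, ?_, ?_, ?_, ?_⟩
  · linear_combination g1 - t * (P0 * P1 - P2 * P3) * hhalf
  · linear_combination g2 - t * (P1 * P3 + P0 * P2) * hhalf
  · linear_combination C (1 / 2) * (f2 - f3) - X4 * hhalf
  · linear_combination C (1 / 2) * (f2 + f3) - X5 * hhalf

end
end

section
/- Let L be an n×n complex matrix satisfying L·L* = Id, where L* denotes the entrywise complex conjugate matrix. Then there exists an invertible n×n complex matrix U such that L = U⁻¹·U*. -/
noncomputable section

lemma Complex.one_add_ofReal_mul_I_ne_zero (t : ℝ) : (1 + t * Complex.I : ℂ) ≠ 0 := fun h => by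
  simpa using congrArg Complex.re h

lemma Complex.injective_cayley :
    Function.Injective fun t : ℝ => (t * Complex.I - 1) / (1 + t * Complex.I) := by
  intro s t hst
  have hs := Complex.one_add_ofReal_mul_I_ne_zero s
  have ht := Complex.one_add_ofReal_mul_I_ne_zero t
  simp only [div_eq_div_iff hs ht] at hst
  have h := congrArg Complex.im hst
  simp at h
  linarith

lemma Matrix.exists_isUnit_det_smul_add {n : Type*} [Fintype n] [DecidableEq n]
    (M : Matrix n n ℂ) :
    ∃ a : ℂ, IsUnit (a • M + starRingEnd ℂ a • (1 : Matrix n n ℂ)).det := by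
  obtain ⟨_, ⟨t, rfl⟩, ht⟩ :=
    (Set.infinite_range_of_injective Complex.injective_cayley).exists_notMem_finset
      M.charpoly.roots.toFinset
  have ha := Complex.one_add_ofReal_mul_I_ne_zero t
  refine ⟨1 + t * Complex.I, isUnit_iff_ne_zero.mpr ?_⟩
  rw [Multiset.mem_toFinset, Polynomial.mem_roots M.charpoly_monic.ne_zero, Polynomial.IsRoot,
    Matrix.eval_charpoly] at ht
  have key : (1 + t * Complex.I) • M + starRingEnd ℂ (1 + t * Complex.I) • (1 : Matrix n n ℂ) =
      (-(1 + t * Complex.I)) •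
        (Matrix.scalar n ((t * Complex.I - 1) / (1 + t * Complex.I)) - M) := by
    rw [Matrix.scalar_apply, ← Matrix.smul_one_eq_diagonal, smul_sub, smul_smul, neg_mul,
      mul_div_cancel₀ _ ha]
    simp only [map_add, map_one, map_mul, Complex.conj_ofReal, Complex.conj_I]
    module
  rw [key, Matrix.det_smul]
  exact mul_ne_zero (pow_ne_zero _ (neg_ne_zero.mpr ha)) ht

/-- If an `n×n` complex matrix `L` satisfies `L·L* = Id`, where `L*` is
the entrywise complex conjugate of `L`, then `L = U⁻¹·U*` for some invertible matrix `U`. -/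
theorem stmt_16 (n : ℕ) (L : Matrix (Fin n) (Fin n) ℂ)
    (h : L * L.map (starRingEnd ℂ) = 1) :
    ∃ U : Matrix (Fin n) (Fin n) ℂ, IsUnit U.det ∧ L = U⁻¹ * U.map (starRingEnd ℂ) := by
  obtain ⟨a, ha⟩ := (L.map (starRingEnd ℂ)).exists_isUnit_det_smul_add
  refine ⟨_, ha, ?_⟩
  set U := a • L.map (starRingEnd ℂ) + starRingEnd ℂ a • (1 : Matrix (Fin n) (Fin n) ℂ) with hU
  have hUL : U * L = U.map (starRingEnd ℂ) := by
    have h_conj : U.map (starRingEnd ℂ) = starRingEnd ℂ a • L + a • 1 := by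
      ext i j
      by_cases hij : i = j <;> simp [hU, hij]
    rw [h_conj, hU, add_mul, smul_mul_assoc, smul_mul_assoc, mul_eq_one_comm.mp h, one_mul,
      add_comm]
  rw [← hUL, Matrix.nonsing_inv_mul_cancel_left _ _ ha]

end
end

section
/- Let L be a 2m×2m complex matrix satisfying L·L* = −Id, where L* denotes the entrywise complex conjugate matrix. Then there exists an invertible 2m×2m complex matrix U such that L = U⁻¹·J·U*, where J is the block matrix (0 −Id_m; Id_m 0). -/
noncomputable section

/-- The `2m×2m` block matrix `J = (0 −Id_m; Id_m 0)`, with rows and columns indexed by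
`Fin m ⊕ Fin m`. -/
def Jmat (m : ℕ) : Matrix (Fin m ⊕ Fin m) (Fin m ⊕ Fin m) ℂ :=
  Matrix.fromBlocks 0 (-1) 1 0

/-- A square complex matrix has some unit-modulus `a` whose square is not an eigenvalue. -/
lemma exists_mul_conj_eq_one_det_scalar_sq_sub_ne_zero {n : Type*} [Fintype n] [DecidableEq n]
    (M : Matrix n n ℂ) :
    ∃ a : ℂ, a * starRingEnd ℂ a = 1 ∧ (Matrix.scalar n (a ^ 2) - M).det ≠ 0 := by
  have hinf : (Metric.sphere (0 : ℂ) 1).Infinite := by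
    refine IsPreconnected.infinite_of_nontrivial ?_ ⟨1, by simp, -1, by simp, ?_⟩
    · exact isPreconnected_sphere (by simp [Complex.rank_real_complex]) 0 1
    · norm_num
  have hq : M.charpoly.comp (Polynomial.X ^ 2) ≠ 0 :=
    (M.charpoly_monic.comp (Polynomial.monic_X_pow 2) (by simp)).ne_zero
  obtain ⟨a, ha, hroot⟩ :=
    hinf.exists_notMem_finset (M.charpoly.comp (Polynomial.X ^ 2)).roots.toFinset
  refine ⟨a, ?_, ?_⟩
  · rw [Complex.mul_conj']
    simp [mem_sphere_zero_iff_norm.mp ha]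
  · simpa [hq, Polynomial.eval_comp, Matrix.eval_charpoly] using hroot

lemma Jmat_mul_self (m : ℕ) : Jmat m * Jmat m = -1 := by
  simp [Jmat, Matrix.fromBlocks_multiply, ← Matrix.fromBlocks_one, Matrix.fromBlocks_neg]

lemma Jmat_map_conj (m : ℕ) : (Jmat m).map (starRingEnd ℂ) = Jmat m := by
  simp [Jmat, Matrix.fromBlocks_map, Matrix.map_neg]

/-- If a `2m×2m` complex matrix `L` satisfies `L·L* = −Id`, where `L*` is
the entrywise complex conjugate of `L`, then `L = U⁻¹·J·U*` for some invertible matrix `U`,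
where `J = (0 −Id_m; Id_m 0)`. -/
theorem stmt_17 (m : ℕ) (L : Matrix (Fin m ⊕ Fin m) (Fin m ⊕ Fin m) ℂ)
    (h : L * L.map (starRingEnd ℂ) = -1) :
    ∃ U : Matrix (Fin m ⊕ Fin m) (Fin m ⊕ Fin m) ℂ, IsUnit U.det ∧
      L = U⁻¹ * (Jmat m * U.map (starRingEnd ℂ)) := by
  obtain ⟨a, ha, hdet⟩ :=
    exists_mul_conj_eq_one_det_scalar_sq_sub_ne_zero (Jmat m * L.map (starRingEnd ℂ))
  have ha' : starRingEnd ℂ a ≠ 0 := right_ne_zero_of_mul_eq_one ha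
  have hL : L.map (starRingEnd ℂ) * L = -1 := by
    rw [← neg_eq_iff_eq_neg, ← neg_mul, mul_eq_one_comm, mul_neg, h, neg_neg]
  set U := a • Jmat m + starRingEnd ℂ a • L.map (starRingEnd ℂ) with hU
  have hJU : Jmat m * U = (-starRingEnd ℂ a) •
      (Matrix.scalar _ (a ^ 2) - Jmat m * L.map (starRingEnd ℂ)) := by
    have hs : starRingEnd ℂ a * a ^ 2 = a := by linear_combination a * ha
    rw [hU, mul_add, mul_smul_comm, mul_smul_comm, Jmat_mul_self, Matrix.scalar_apply,
      ← Matrix.smul_one_eq_diagonal, smul_sub, smul_smul, neg_mul, hs]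
    simp
  have hUdet : IsUnit U.det := by
    refine isUnit_iff_ne_zero.mpr (right_ne_zero_of_mul (a := (Jmat m).det) ?_)
    rw [← Matrix.det_mul, hJU, Matrix.det_smul]
    exact mul_ne_zero (pow_ne_zero _ (neg_ne_zero.mpr ha')) hdet
  have hUconj : U.map (starRingEnd ℂ) = starRingEnd ℂ a • Jmat m + a • L := by
    conv_rhs => rw [← Jmat_map_conj]
    ext i j
    simp [hU]
  refine ⟨U, hUdet, ?_⟩
  have key : U * L = Jmat m * U.map (starRingEnd ℂ) := by
    rw [hUconj, hU, add_mul, mul_add, smul_mul_assoc, smul_mul_assoc, mul_smul_comm,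
      mul_smul_comm, hL, Jmat_mul_self, add_comm]
  rw [← key, Matrix.nonsing_inv_mul_cancel_left _ _ hUdet]

end
end

section
/- Consider the Veronese map V : P²(ℂ) → P⁵(ℂ), (u : v : w) ↦ (w² : wu : wv : u² : uv : v²). Then V is injective, and the Veronese surface V(P²(ℂ)) contains no projective line of P⁵(ℂ). -/
noncomputable section

/-- The Veronese map on the level of vectors: `(u, v, w) ↦ (w², wu, wv, u², uv, v²)`,
inducing the Veronese map `P²(ℂ) → P⁵(ℂ)`, `(u : v : w) ↦ (w² : wu : wv : u² : uv : v²)`. -/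
def veronese (x : Fin 3 → ℂ) : Fin 6 → ℂ :=
  ![x 2 ^ 2, x 2 * x 0, x 2 * x 1, x 0 ^ 2, x 0 * x 1, x 1 ^ 2]

/-- Every product of two coordinates of `x` is a coordinate of `veronese x`. -/
theorem exists_veronese_apply_eq_mul (i j : Fin 3) :
    ∃ k : Fin 6, ∀ x : Fin 3 → ℂ, veronese x k = x i * x j := by
  fin_cases i <;> fin_cases j
  · exact ⟨3, fun x => sq _⟩
  · exact ⟨4, fun x => rfl⟩
  · exact ⟨1, fun x => mul_comm _ _⟩
  · exact ⟨4, fun x => mul_comm _ _⟩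
  · exact ⟨5, fun x => sq _⟩
  · exact ⟨2, fun x => mul_comm _ _⟩
  · exact ⟨1, fun x => rfl⟩
  · exact ⟨2, fun x => rfl⟩
  · exact ⟨0, fun x => sq _⟩

theorem veronese_smul (t : ℂ) (x : Fin 3 → ℂ) : veronese (t • x) = t ^ 2 • veronese x := by
  ext k
  fin_cases k <;> simp [veronese] <;> ring

/-- Two nonzero vectors with proportional Veronese images are proportional. -/
theorem exists_smul_of_veronese_eq_smul {x y : Fin 3 → ℂ} (hy : y ≠ 0) {c : ℂ} (hc : c ≠ 0)
    (h : veronese x = c • veronese y) : ∃ t : ℂ, t ≠ 0 ∧ x = t • y := by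
  have hmul (i j : Fin 3) : x i * x j = c * (y i * y j) := by
    obtain ⟨k, hk⟩ := exists_veronese_apply_eq_mul i j
    simpa [hk] using congrFun h k
  obtain ⟨i, hi⟩ := Function.ne_iff.mp hy
  have hi : y i ≠ 0 := hi
  have hx : x i ≠ 0 := by
    intro hx
    have := hmul i i
    simp [hx, hc, hi] at this
  refine ⟨c * y i / x i, by positivity, ?_⟩
  ext j
  simp only [Pi.smul_apply, smul_eq_mul]
  field_simp
  linear_combination hmul i j

/-- If a combination with nonzero coefficients of two Veronese images is a multiple of a Veronese
image, then the two vectors are proportional. -/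
theorem exists_smul_of_smul_veronese_add {x y z : Fin 3 → ℂ} (hy : y ≠ 0) {c d e : ℂ}
    (hc : c ≠ 0) (hd : d ≠ 0)
    (h : c • veronese x + d • veronese y = e • veronese z) : ∃ t : ℂ, x = t • y := by
  have hmul (i j : Fin 3) : c * (x i * x j) + d * (y i * y j) = e * (z i * z j) := by
    obtain ⟨k, hk⟩ := exists_veronese_apply_eq_mul i j
    simpa [hk] using congrFun h k
  have hminor (i j : Fin 3) : x i * y j - x j * y i = 0 := by
    have hsq : c * d * (x i * y j - x j * y i) ^ 2 = 0 := by
      linear_combination (c * (x j * x j) + d * (y j * y j)) * hmul i i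
        + e * (z i * z i) * hmul j j
        - (c * (x i * x j) + d * (y i * y j) + e * (z i * z j)) * hmul i j
    simpa [hc, hd] using hsq
  obtain ⟨i, hi⟩ := Function.ne_iff.mp hy
  have hi : y i ≠ 0 := hi
  refine ⟨x i / y i, ?_⟩
  ext j
  simp only [Pi.smul_apply, smul_eq_mul]
  field_simp
  linear_combination -hminor i j

/-- The Veronese map `V : P²(ℂ) → P⁵(ℂ)` is injective, and the Veronese
surface `V(P²(ℂ))` contains no projective line of `P⁵(ℂ)` (stated on the level of nonzero
vectors: projective points are nonzero vectors up to a nonzero scalar, a projective line is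
the projectivization of a 2-dimensional linear subspace `W ⊆ ℂ⁶`, and a line lies in the
Veronese surface iff every nonzero vector of `W` is a nonzero multiple of some `veronese x`). -/
theorem stmt_19 :
    -- injectivity of the Veronese map on P²(ℂ) :
    (∀ x y : Fin 3 → ℂ, x ≠ 0 → y ≠ 0 →
      (∃ c : ℂ, c ≠ 0 ∧ veronese x = c • veronese y) →
      ∃ c : ℂ, c ≠ 0 ∧ x = c • y) ∧
    -- the Veronese surface contains no projective line :
    ¬∃ W : Submodule ℂ (Fin 6 → ℂ), Module.finrank ℂ W = 2 ∧
      ∀ y ∈ W, y ≠ 0 → ∃ (x : Fin 3 → ℂ) (c : ℂ), x ≠ 0 ∧ c ≠ 0 ∧ y = c • veronese x := by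
  refine ⟨fun x y _ hy ⟨c, hc, h⟩ => exists_smul_of_veronese_eq_smul hy hc h, ?_⟩
  rintro ⟨W, hW, hV⟩
  have : Module.Finite ℂ W := Module.finite_of_finrank_eq_succ hW
  let B := Module.finBasisOfFinrankEq ℂ W hW
  have hB : LinearIndependent ℂ ![(B 0 : Fin 6 → ℂ), (B 1 : Fin 6 → ℂ)] := by
    have hpair : ![(B 0 : Fin 6 → ℂ), (B 1 : Fin 6 → ℂ)] = W.subtype ∘ B := by
      funext i
      fin_cases i <;> rfl
    exact hpair ▸ B.linearIndependent.map' W.subtype W.ker_subtype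
  rw [LinearIndependent.pair_iff] at hB
  have h0 : (B 0 : Fin 6 → ℂ) ≠ 0 := fun h => by simpa using hB 1 0 (by simp [h])
  have h1 : (B 1 : Fin 6 → ℂ) ≠ 0 := fun h => by simpa using hB 0 1 (by simp [h])
  have h01 : (B 0 : Fin 6 → ℂ) + B 1 ≠ 0 := fun h => by simpa using hB 1 1 (by simpa using h)
  obtain ⟨x, c, -, hc, hx⟩ := hV _ (B 0).2 h0
  obtain ⟨y, d, hy0, hd, hy⟩ := hV _ (B 1).2 h1
  obtain ⟨z, e, -, -, hz⟩ := hV _ (W.add_mem (B 0).2 (B 1).2) h01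
  obtain ⟨t, rfl⟩ := exists_smul_of_smul_veronese_add hy0 hc hd (hx ▸ hy ▸ hz)
  refine hd (hB d (-(c * t ^ 2)) ?_).1
  rw [hx, hy, veronese_smul]
  module

end
end
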